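/- Assume in addition that ξ×H = 0. Then det(τ·Id₈ + A(ξ)) = τ²·(τ² − c²|ξ|²)·(τ² − h²|ξ|²)² for every τ ∈ ℝ. In particular, when ξ ≠ 0, H ≠ 0, γp > 0 and |H|² ≠ γp, the eigenvalue 0 of A(ξ) has algebraic multiplicity 2, ±c|ξ| are simple eigenvalues, and ±h|ξ| are eigenvalues of algebraic multiplicity 2. -/

import Mathlib

open Matrix

noncomputable section

/-- Euclidean dot product on `ℝ³`. -/
def dot3 (a b : Fin 3 → ℝ) : ℝ := a 0 * b 0 + a 1 * b 1 + a 2 * b 2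

/-- Cross product on `ℝ³`. -/
def cross3 (a b : Fin 3 → ℝ) : Fin 3 → ℝ :=
  ![a 1 * b 2 - a 2 * b 1, a 2 * b 0 - a 0 * b 2, a 0 * b 1 - a 1 * b 0]

/-- The sound speed squared `c² = γp/ρ`. -/
def csq (ρ γ p : ℝ) : ℝ := γ * p / ρ

/-- The Alfvén speed squared `h² = |H|²/ρ`. -/
def hsq (ρ : ℝ) (H : Fin 3 → ℝ) : ℝ := dot3 H H / ρ

/-- `b²(ξ) = |ξ×H|²/ρ`. -/
def bsq (ρ : ℝ) (H ξ : Fin 3 → ℝ) : ℝ := dot3 (cross3 ξ H) (cross3 ξ H) / ρ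

/-- The slow magnetosonic speed squared `c_s²(ξ)`. -/
def cs2 (ρ γ p : ℝ) (H ξ : Fin 3 → ℝ) : ℝ :=
  ((csq ρ γ p + hsq ρ H) * dot3 ξ ξ
    - Real.sqrt ((csq ρ γ p - hsq ρ H) ^ 2 * (dot3 ξ ξ) ^ 2
        + 4 * bsq ρ H ξ * csq ρ γ p * dot3 ξ ξ)) / 2

/-- The fast magnetosonic speed squared `c_f²(ξ)`. -/
def cf2 (ρ γ p : ℝ) (H ξ : Fin 3 → ℝ) : ℝ :=
  ((csq ρ γ p + hsq ρ H) * dot3 ξ ξ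
    + Real.sqrt ((csq ρ γ p - hsq ρ H) ^ 2 * (dot3 ξ ξ) ^ 2
        + 4 * bsq ρ H ξ * csq ρ γ p * dot3 ξ ξ)) / 2

/-- The matrix `A(ξ) = q(0,ξ)` of the principal symbol of the linearized ideal
MHD system in the coordinates `(ρ̇,u̇₁,u̇₂,u̇₃,Ḣ₁,Ḣ₂,Ḣ₃,ṗ)`, so that
`q(τ,ξ) = τ·Id₈ + A(ξ)`. -/
def Amat (ρ γ p : ℝ) (H ξ : Fin 3 → ℝ) : Matrix (Fin 8) (Fin 8) ℝ :=
  !![0, ρ * ξ 0, ρ * ξ 1, ρ * ξ 2, 0, 0, 0, 0;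
     0, 0, 0, 0, (ξ 0 * H 0 - dot3 H ξ) / ρ, (ξ 0 * H 1) / ρ, (ξ 0 * H 2) / ρ, ξ 0 / ρ;
     0, 0, 0, 0, (ξ 1 * H 0) / ρ, (ξ 1 * H 1 - dot3 H ξ) / ρ, (ξ 1 * H 2) / ρ, ξ 1 / ρ;
     0, 0, 0, 0, (ξ 2 * H 0) / ρ, (ξ 2 * H 1) / ρ, (ξ 2 * H 2 - dot3 H ξ) / ρ, ξ 2 / ρ;
     0, H 0 * ξ 0 - dot3 H ξ, H 0 * ξ 1, H 0 * ξ 2, 0, 0, 0, 0;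
     0, H 1 * ξ 0, H 1 * ξ 1 - dot3 H ξ, H 1 * ξ 2, 0, 0, 0, 0;
     0, H 2 * ξ 0, H 2 * ξ 1, H 2 * ξ 2 - dot3 H ξ, 0, 0, 0, 0;
     0, γ * p * ξ 0, γ * p * ξ 1, γ * p * ξ 2, 0, 0, 0, 0]

/-- The indices of the velocity block followed by those of the remaining unknowns. -/
def velocityEquiv : Fin 3 ⊕ Fin 5 ≃ Fin 8 :=
  Equiv.ofBijective (Sum.elim ![1, 2, 3] ![0, 4, 5, 6, 7]) (by decide)

/-- The block of `A(ξ)` giving the action on the velocity. -/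
def velocityRows (ρ : ℝ) (H ξ : Fin 3 → ℝ) : Matrix (Fin 3) (Fin 5) ℝ :=
  !![0, (ξ 0 * H 0 - dot3 H ξ) / ρ, (ξ 0 * H 1) / ρ, (ξ 0 * H 2) / ρ, ξ 0 / ρ;
     0, (ξ 1 * H 0) / ρ, (ξ 1 * H 1 - dot3 H ξ) / ρ, (ξ 1 * H 2) / ρ, ξ 1 / ρ;
     0, (ξ 2 * H 0) / ρ, (ξ 2 * H 1) / ρ, (ξ 2 * H 2 - dot3 H ξ) / ρ, ξ 2 / ρ]

/-- The block of `A(ξ)` giving the action of the velocity on the other unknowns. -/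
def velocityCols (ρ γ p : ℝ) (H ξ : Fin 3 → ℝ) : Matrix (Fin 5) (Fin 3) ℝ :=
  !![ρ * ξ 0, ρ * ξ 1, ρ * ξ 2;
     H 0 * ξ 0 - dot3 H ξ, H 0 * ξ 1, H 0 * ξ 2;
     H 1 * ξ 0, H 1 * ξ 1 - dot3 H ξ, H 1 * ξ 2;
     H 2 * ξ 0, H 2 * ξ 1, H 2 * ξ 2 - dot3 H ξ;
     γ * p * ξ 0, γ * p * ξ 1, γ * p * ξ 2]

theorem Amat_submatrix_velocityEquiv (ρ γ p : ℝ) (H ξ : Fin 3 → ℝ) :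
    (Amat ρ γ p H ξ).submatrix velocityEquiv velocityEquiv
      = fromBlocks 0 (velocityRows ρ H ξ) (velocityCols ρ γ p H ξ) 0 := by
  ext (i | i) (j | j) <;> fin_cases i <;> fin_cases j <;> rfl

theorem exists_eq_smul_of_cross3_eq_zero {ξ H : Fin 3 → ℝ} (hξ : ξ ≠ 0)
    (h : cross3 ξ H = 0) : ∃ l : ℝ, H = l • ξ := by
  have h0 := congrFun h 0
  have h1 := congrFun h 1
  have h2 := congrFun h 2
  simp only [cross3, cons_val, Pi.zero_apply] at h0 h1 h2
  obtain ⟨i, hi⟩ := Function.ne_iff.mp hξ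
  refine ⟨H i / ξ i, funext fun j => ?_⟩
  rw [Pi.zero_apply] at hi
  rw [Pi.smul_apply, smul_eq_mul, div_mul_eq_mul_div, eq_div_iff hi]
  fin_cases i <;> fin_cases j <;> simp only [Fin.zero_eta, Fin.mk_one, Fin.reduceFinMk] <;>
    linarith

theorem velocityRows_mul_velocityCols {ρ : ℝ} (γ p : ℝ) (ξ : Fin 3 → ℝ) (l : ℝ) :
    velocityRows ρ (l • ξ) ξ * velocityCols ρ γ p (l • ξ) ξ
      = (hsq ρ (l • ξ) * dot3 ξ ξ) • (1 : Matrix (Fin 3) (Fin 3) ℝ)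
        + (csq ρ γ p - hsq ρ (l • ξ)) • vecMulVec ξ ξ := by
  ext i j
  fin_cases i <;> fin_cases j <;>
    simp [velocityRows, velocityCols, hsq, csq, dot3, Matrix.mul_apply, Fin.sum_univ_succ,
      vecMulVec_apply] <;> ring

theorem det_smul_one_add_smul_vecMulVec (a b : ℝ) (ξ : Fin 3 → ℝ) :
    (a • (1 : Matrix (Fin 3) (Fin 3) ℝ) + b • vecMulVec ξ ξ).det
      = a ^ 2 * (a + b * dot3 ξ ξ) := by
  simp [det_fin_three, vecMulVec_apply, dot3]
  ring

theorem det_smul_one_add_Amat_of_ne_zero (ρ γ p : ℝ) (H ξ : Fin 3 → ℝ) {τ : ℝ} (hτ : τ ≠ 0) :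
    (τ • (1 : Matrix (Fin 8) (Fin 8) ℝ) + Amat ρ γ p H ξ).det
      = τ ^ 2 * (τ ^ 2 • (1 : Matrix (Fin 3) (Fin 3) ℝ)
          - velocityRows ρ H ξ * velocityCols ρ γ p H ξ).det := by
  have hblock : (τ • (1 : Matrix (Fin 8) (Fin 8) ℝ) + Amat ρ γ p H ξ).submatrix
      velocityEquiv velocityEquiv
      = fromBlocks (τ • 1) (velocityRows ρ H ξ) (velocityCols ρ γ p H ξ) (τ • 1) := by
    rw [submatrix_add, Pi.add_apply, Pi.add_apply, submatrix_smul, Pi.smul_apply, Pi.smul_apply,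
      submatrix_one_equiv, Amat_submatrix_velocityEquiv, ← fromBlocks_one, fromBlocks_smul,
      fromBlocks_add]
    simp
  let inst : Invertible (τ • (1 : Matrix (Fin 5) (Fin 5) ℝ)) :=
    ⟨τ⁻¹ • 1, by simp [smul_smul, hτ], by simp [smul_smul, hτ]⟩
  have hinv : ⅟(τ • (1 : Matrix (Fin 5) (Fin 5) ℝ)) = τ⁻¹ • 1 := rfl
  have hscale : τ ^ 2 • (1 : Matrix (Fin 3) (Fin 3) ℝ)
      - velocityRows ρ H ξ * velocityCols ρ γ p H ξ
      = τ • (τ • 1 - velocityRows ρ H ξ * (τ⁻¹ • (1 : Matrix (Fin 5) (Fin 5) ℝ))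
          * velocityCols ρ γ p H ξ) := by
    rw [smul_sub, smul_smul, Matrix.mul_smul, Matrix.mul_one, Matrix.smul_mul, smul_inv_smul₀ hτ,
      sq]
  rw [← det_submatrix_equiv_self velocityEquiv, hblock, det_fromBlocks₂₂, hinv, hscale,
    det_smul, det_smul, det_one]
  simp only [Fintype.card_fin]
  ring

theorem det_smul_one_add_Amat {ρ γ p : ℝ} {H ξ : Fin 3 → ℝ} (h : cross3 ξ H = 0) (τ : ℝ) :
    (τ • (1 : Matrix (Fin 8) (Fin 8) ℝ) + Amat ρ γ p H ξ).det
      = τ ^ 2 * (τ ^ 2 - csq ρ γ p * dot3 ξ ξ) * (τ ^ 2 - hsq ρ H * dot3 ξ ξ) ^ 2 := by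
  suffices hne : ∀ t : ℝ, t ≠ 0 →
      (t • (1 : Matrix (Fin 8) (Fin 8) ℝ) + Amat ρ γ p H ξ).det
        = t ^ 2 * (t ^ 2 - csq ρ γ p * dot3 ξ ξ) * (t ^ 2 - hsq ρ H * dot3 ξ ξ) ^ 2 by
    have hcont : Continuous fun t : ℝ =>
        (t • (1 : Matrix (Fin 8) (Fin 8) ℝ) + Amat ρ γ p H ξ).det := by fun_prop
    exact congrFun (hcont.ext_on (dense_compl_singleton (0 : ℝ)) (by fun_prop) hne) τ
  intro t ht
  rw [det_smul_one_add_Amat_of_ne_zero ρ γ p H ξ ht]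
  by_cases hξ : ξ = 0
  · subst hξ
    have hrows : velocityRows ρ H 0 = 0 := by
      ext i j
      fin_cases i <;> fin_cases j <;> simp [velocityRows, dot3]
    rw [hrows, Matrix.zero_mul, sub_zero, det_smul, det_one, Fintype.card_fin]
    simp only [dot3, Pi.zero_apply]
    ring
  · obtain ⟨l, rfl⟩ := exists_eq_smul_of_cross3_eq_zero hξ h
    rw [velocityRows_mul_velocityCols, ← sub_sub, ← sub_smul, sub_eq_add_neg, ← neg_smul,
      det_smul_one_add_smul_vecMulVec]
    ring

open Polynomial in
theorem charpoly_Amat {ρ γ p : ℝ} {H ξ : Fin 3 → ℝ} (h : cross3 ξ H = 0) {a b : ℝ}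
    (ha : a ^ 2 = csq ρ γ p * dot3 ξ ξ) (hb : b ^ 2 = hsq ρ H * dot3 ξ ξ) :
    (Amat ρ γ p H ξ).charpoly
      = X ^ 2 * (X - C a) * (X + C a) * (X - C b) ^ 2 * (X + C b) ^ 2 := by
  refine Polynomial.funext fun t => ?_
  have hneg : scalar (Fin 8) t - Amat ρ γ p H ξ
      = -((-t) • (1 : Matrix (Fin 8) (Fin 8) ℝ) + Amat ρ γ p H ξ) := by
    rw [neg_smul, neg_add, neg_neg, ← sub_eq_add_neg, smul_one_eq_diagonal, scalar_apply]
  rw [eval_charpoly, hneg, det_neg, det_smul_one_add_Amat h, ← ha, ← hb]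
  simp only [Fintype.card_fin, eval_mul, eval_pow, eval_sub, eval_add, eval_X, eval_C]
  ring

open Polynomial in
theorem rootMultiplicity_eq_of_eq_pow_mul {R : Type*} [CommRing R] [IsDomain R] {P Q : R[X]}
    {x : R} {n : ℕ} (h : P = (X - C x) ^ n * Q) (hQ : Q.eval x ≠ 0) :
    P.rootMultiplicity x = n := by
  have hQ0 : Q ≠ 0 := by
    rintro rfl
    exact hQ eval_zero
  rw [h, mul_comm, rootMultiplicity_mul_X_sub_C_pow hQ0, rootMultiplicity_eq_zero hQ, zero_add]

theorem dot3_self_pos {v : Fin 3 → ℝ} (hv : v ≠ 0) : 0 < dot3 v v := by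
  have hd : dot3 v v = v ⬝ᵥ v := by simp [dot3, dotProduct, Fin.sum_univ_three]
  rw [hd]
  exact (Finset.sum_nonneg fun i _ => mul_self_nonneg (v i)).lt_of_ne'
    (dotProduct_self_eq_zero.not.mpr hv)

/-- If `ξ×H = 0` then `det(τ·Id₈ + A(ξ)) = τ²·(τ² − c²|ξ|²)·(τ² − h²|ξ|²)²`.
In particular, when `ξ ≠ 0`, `H ≠ 0`, `γp > 0` and `|H|² ≠ γp`, the eigenvalue
`0` of `A(ξ)` has algebraic multiplicity `2`, `±c|ξ|` are simple eigenvalues,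
and `±h|ξ|` are eigenvalues of algebraic multiplicity `2`. -/
theorem stmt13 (ρ γ p : ℝ) (H ξ : Fin 3 → ℝ)
    (hρ : 0 < ρ) (hcross : cross3 ξ H = 0) :
    (∀ τ : ℝ,
      (τ • (1 : Matrix (Fin 8) (Fin 8) ℝ) + Amat ρ γ p H ξ).det
        = τ ^ 2 * (τ ^ 2 - csq ρ γ p * dot3 ξ ξ)
            * (τ ^ 2 - hsq ρ H * dot3 ξ ξ) ^ 2) ∧
    (ξ ≠ 0 → H ≠ 0 → 0 < γ * p → dot3 H H ≠ γ * p →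
      Polynomial.rootMultiplicity 0 (Amat ρ γ p H ξ).charpoly = 2 ∧
      Polynomial.rootMultiplicity
          (Real.sqrt (csq ρ γ p) * Real.sqrt (dot3 ξ ξ))
          (Amat ρ γ p H ξ).charpoly = 1 ∧
      Polynomial.rootMultiplicity
          (-(Real.sqrt (csq ρ γ p) * Real.sqrt (dot3 ξ ξ)))
          (Amat ρ γ p H ξ).charpoly = 1 ∧
      Polynomial.rootMultiplicity
          (Real.sqrt (hsq ρ H) * Real.sqrt (dot3 ξ ξ))
          (Amat ρ γ p H ξ).charpoly = 2 ∧
      Polynomial.rootMultiplicity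
          (-(Real.sqrt (hsq ρ H) * Real.sqrt (dot3 ξ ξ)))
          (Amat ρ γ p H ξ).charpoly = 2) := by
  refine ⟨det_smul_one_add_Amat hcross, fun hξ hH hγp hne => ?_⟩
  have hξ' := dot3_self_pos hξ
  have hc : 0 < csq ρ γ p := div_pos hγp hρ
  have hh : 0 < hsq ρ H := div_pos (dot3_self_pos hH) hρ
  have hch : csq ρ γ p ≠ hsq ρ H := fun e => hne ((div_left_inj' hρ.ne').mp e).symm
  have ha : (√(csq ρ γ p) * √(dot3 ξ ξ)) ^ 2 = csq ρ γ p * dot3 ξ ξ := by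
    rw [mul_pow, Real.sq_sqrt hc.le, Real.sq_sqrt hξ'.le]
  have hb : (√(hsq ρ H) * √(dot3 ξ ξ)) ^ 2 = hsq ρ H * dot3 ξ ξ := by
    rw [mul_pow, Real.sq_sqrt hh.le, Real.sq_sqrt hξ'.le]
  have ha0 : 0 < √(csq ρ γ p) * √(dot3 ξ ξ) :=
    mul_pos (Real.sqrt_pos.mpr hc) (Real.sqrt_pos.mpr hξ')
  have hb0 : 0 < √(hsq ρ H) * √(dot3 ξ ξ) :=
    mul_pos (Real.sqrt_pos.mpr hh) (Real.sqrt_pos.mpr hξ')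
  have hP := charpoly_Amat hcross ha hb
  have hab : √(csq ρ γ p) * √(dot3 ξ ξ) ≠ √(hsq ρ H) * √(dot3 ξ ξ) := by
    intro e
    rw [e, hb] at ha
    exact hch (mul_right_cancel₀ hξ'.ne' ha).symm
  generalize √(csq ρ γ p) * √(dot3 ξ ξ) = a at *
  generalize √(hsq ρ H) * √(dot3 ξ ξ) = b at *
  have hsub : a - b ≠ 0 := sub_ne_zero.mpr hab
  have hsub' : b - a ≠ 0 := sub_ne_zero.mpr hab.symm
  have hsum : a + b ≠ 0 := (add_pos ha0 hb0).ne'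
  rw [hP]
  open Polynomial in
  refine ⟨
    rootMultiplicity_eq_of_eq_pow_mul
      (Q := (X - C a) * (X + C a) * (X - C b) ^ 2 * (X + C b) ^ 2) ?_ ?_,
    rootMultiplicity_eq_of_eq_pow_mul
      (Q := X ^ 2 * (X + C a) * (X - C b) ^ 2 * (X + C b) ^ 2) ?_ ?_,
    rootMultiplicity_eq_of_eq_pow_mul
      (Q := X ^ 2 * (X - C a) * (X - C b) ^ 2 * (X + C b) ^ 2) ?_ ?_,
    rootMultiplicity_eq_of_eq_pow_mul
      (Q := X ^ 2 * (X - C a) * (X + C a) * (X + C b) ^ 2) ?_ ?_,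
    rootMultiplicity_eq_of_eq_pow_mul
      (Q := X ^ 2 * (X - C a) * (X + C a) * (X - C b) ^ 2) ?_ ?_⟩
  · rw [C_0]; ring
  · simp [ha0.ne', hb0.ne']
  · ring
  · simp [ha0.ne', hsub, hsum]
  · rw [C_neg]; ring
  · have e₁ : -a - a ≠ 0 := (by linarith : -a - a < 0).ne
    have e₂ : -a - b ≠ 0 := (by linarith : -a - b < 0).ne
    have e₃ : -a + b ≠ 0 := by rwa [neg_add_eq_sub]
    simp [ha0.ne', e₁, e₂, e₃]
  · ring
  · have e : b + a ≠ 0 := by rwa [add_comm]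
    simp [hb0.ne', hsub', e]
  · rw [C_neg]; ring
  · have e₁ : -b - b ≠ 0 := (by linarith : -b - b < 0).ne
    have e₂ : -b - a ≠ 0 := (by linarith : -b - a < 0).ne
    have e₃ : -b + a ≠ 0 := by rwa [neg_add_eq_sub]
    simp [hb0.ne', e₁, e₂, e₃]
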